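/- For every real 0 < c ≤ 2^{−100} there is a constant C such that for all sufficiently large N the following holds: setting Q := exp((log N)^c), one has (1/(N·log N))·∑_{n=1}^{N} |τ_{≤Q;N}(n) − (log N)·τ_{≤Q}(n)| ≤ C·(log N)^{−1/10}. -/

import Mathlib

/-- `e(t) = exp(2πit)`. -/
noncomputable def expCirc (t : ℝ) : ℂ := Complex.exp (2 * Real.pi * Complex.I * t)

/-- `τ_{≤Q;N}(n) = ∑_{q ≤ Q} ∑_{1 ≤ a ≤ q, (a,q)=1} (1/q)(log N + 2γ − 1 − 2 log q) e(n a/q)`. -/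
noncomputable def tauApproxN (Q : ℝ) (N : ℕ) (n : ℤ) : ℂ :=
  ∑ q ∈ Finset.Icc 1 ⌊Q⌋₊, ∑ a ∈ (Finset.Icc 1 q).filter (fun a => Nat.Coprime a q),
    ((q : ℂ))⁻¹ *
      ((Real.log N + 2 * Real.eulerMascheroniConstant - 1 - 2 * Real.log q : ℝ) : ℂ) *
      expCirc ((n : ℝ) * a / q)

/-- `τ_{≤Q}(n) = ∑_{q ≤ Q} ∑_{1 ≤ a ≤ q, (a,q)=1} (1/q) e(n a/q)`. -/
noncomputable def tauApprox (Q : ℝ) (n : ℤ) : ℂ :=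
  ∑ q ∈ Finset.Icc 1 ⌊Q⌋₊, ∑ a ∈ (Finset.Icc 1 q).filter (fun a => Nat.Coprime a q),
    ((q : ℂ))⁻¹ * expCirc ((n : ℝ) * a / q)

theorem expCirc_nat_mul (k : ℕ) (t : ℝ) : expCirc (k * t) = expCirc t ^ k := by
  rw [expCirc, expCirc, ← Complex.exp_nat_mul]
  congr 1
  push_cast
  ring

theorem expCirc_int (k : ℤ) : expCirc k = 1 := by
  rw [expCirc, Complex.exp_eq_one_iff]
  exact ⟨k, by push_cast; ring⟩

theorem norm_expCirc (t : ℝ) : ‖expCirc t‖ = 1 := by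
  have h : (2 * Real.pi * Complex.I * t : ℂ) = ((2 * Real.pi * t : ℝ) : ℂ) * Complex.I := by
    push_cast
    ring
  rw [expCirc, h, Complex.norm_exp_ofReal_mul_I]

theorem exists_int_of_expCirc_eq_one {t : ℝ} (h : expCirc t = 1) : ∃ k : ℤ, t = k := by
  rw [expCirc, Complex.exp_eq_one_iff] at h
  obtain ⟨k, hk⟩ := h
  refine ⟨k, ?_⟩
  have hpi : (2 * Real.pi * Complex.I : ℂ) ≠ 0 := Complex.two_pi_I_ne_zero
  have htk : (t : ℂ) = k := mul_left_cancel₀ hpi (by rw [hk]; ring)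
  exact_mod_cast htk

/-- A complete sum of additive characters modulo `m` is at most `m`, and vanishes unless
`m ∣ n`. -/
theorem norm_sum_expCirc_le {m : ℕ} (hm : 0 < m) (n : ℤ) :
    ‖∑ b ∈ Finset.Icc 1 m, expCirc ((n : ℝ) * b / m)‖ ≤ if (m : ℤ) ∣ n then (m : ℝ) else 0 := by
  split_ifs with hd
  · refine (norm_sum_le _ _).trans ?_
    simp [norm_expCirc]
  · have hm' : (m : ℝ) ≠ 0 := by positivity
    have hpow (b : ℕ) : expCirc ((n : ℝ) * b / m) = expCirc ((n : ℝ) / m) ^ b := by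
      rw [← expCirc_nat_mul]
      congr 1
      ring
    have hne : expCirc ((n : ℝ) / m) ≠ 1 := by
      intro h
      obtain ⟨k, hk⟩ := exists_int_of_expCirc_eq_one h
      refine hd ⟨k, ?_⟩
      rw [div_eq_iff hm'] at hk
      have : (n : ℝ) = ((k * m : ℤ) : ℝ) := by rw [hk]; push_cast; ring
      rw [mul_comm]
      exact_mod_cast this
    have hone : expCirc ((n : ℝ) / m) ^ m = 1 := by
      rw [← expCirc_nat_mul, mul_div_cancel₀ _ hm', expCirc_int]
    simp_rw [hpow]
    have hIcc : Finset.Icc 1 m = Finset.Ico 1 (m + 1) := rfl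
    rw [hIcc, geom_sum_Ico hne (by omega), pow_succ, hone]
    simp

/-- The Möbius function detects coprimality. -/
theorem sum_moebius_dvd_eq_ite {q : ℕ} (hq : q ≠ 0) (a : ℕ) :
    (∑ d ∈ q.divisors, if d ∣ a then ArithmeticFunction.moebius d else 0) =
      if a.Coprime q then 1 else 0 := by
  have h : q.divisors.filter (· ∣ a) = (a.gcd q).divisors := by
    ext d
    simp only [Finset.mem_filter, Nat.mem_divisors, Nat.dvd_gcd_iff, ne_eq, Nat.gcd_eq_zero_iff]
    tauto
  rw [← Finset.sum_filter, h, ← ArithmeticFunction.coe_mul_zeta_apply,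
    ArithmeticFunction.moebius_mul_coe_zeta, ArithmeticFunction.one_apply]

theorem sum_Icc_filter_dvd {M : Type*} [AddCommMonoid M] {q d : ℕ} (hd : d ∣ q) (hq : 0 < q)
    (f : ℕ → M) :
    ∑ a ∈ (Finset.Icc 1 q).filter (d ∣ ·), f a = ∑ b ∈ Finset.Icc 1 (q / d), f (d * b) := by
  have hd0 : 0 < d := Nat.pos_of_dvd_of_pos hd hq
  symm
  refine Finset.sum_bij (fun b _ => d * b) ?_ ?_ ?_ (fun _ _ => rfl)
  · intro b hb
    rw [Finset.mem_Icc, Nat.le_div_iff_mul_le hd0] at hb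
    simp only [Finset.mem_filter, Finset.mem_Icc, dvd_mul_right, and_true]
    exact ⟨Nat.mul_pos hd0 hb.1, by linarith [hb.2]⟩
  · intro b _ b' _ h
    exact Nat.eq_of_mul_eq_mul_left hd0 h
  · rintro a ha
    simp only [Finset.mem_filter, Finset.mem_Icc] at ha
    obtain ⟨⟨h1, h2⟩, b, rfl⟩ := ha
    refine ⟨b, ?_, rfl⟩
    rw [Finset.mem_Icc, Nat.le_div_iff_mul_le hd0]
    exact ⟨Nat.pos_of_mul_pos_left h1, by linarith⟩

/-- The Ramanujan sum `c_q(n)` is bounded by the sum of the common divisors of `q` and `n`. -/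
theorem norm_ramanujan_sum_le {q : ℕ} (hq : 0 < q) (n : ℤ) :
    ‖∑ a ∈ (Finset.Icc 1 q).filter (fun a => Nat.Coprime a q), expCirc ((n : ℝ) * a / q)‖ ≤
      ∑ m ∈ q.divisors, if (m : ℤ) ∣ n then (m : ℝ) else 0 := by
  have hmoeb : ∑ a ∈ (Finset.Icc 1 q).filter (fun a => Nat.Coprime a q),
        expCirc ((n : ℝ) * a / q) =
      ∑ d ∈ q.divisors, (ArithmeticFunction.moebius d : ℂ) *
        ∑ b ∈ Finset.Icc 1 (q / d), expCirc ((n : ℝ) * b / (q / d : ℕ)) := by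
    have hterm (a : ℕ) : (if a.Coprime q then expCirc ((n : ℝ) * a / q) else 0) =
        ∑ d ∈ q.divisors, if d ∣ a then
          (ArithmeticFunction.moebius d : ℂ) * expCirc ((n : ℝ) * a / q) else 0 := by
      have h := congrArg (fun z : ℤ => (z : ℂ) * expCirc ((n : ℝ) * a / q))
        (sum_moebius_dvd_eq_ite hq.ne' a)
      simp only [Int.cast_sum, Finset.sum_mul] at h
      convert h.symm using 1
      · split_ifs <;> simp
      · refine Finset.sum_congr rfl fun d _ => ?_
        split_ifs <;> simp
    rw [Finset.sum_filter, Finset.sum_congr rfl fun a _ => hterm a, Finset.sum_comm]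
    refine Finset.sum_congr rfl fun d hd => ?_
    have hdq := Nat.dvd_of_mem_divisors hd
    rw [← Finset.sum_filter, sum_Icc_filter_dvd hdq hq, Finset.mul_sum]
    refine Finset.sum_congr rfl fun b _ => ?_
    obtain ⟨m, rfl⟩ := hdq
    have hd0 : 0 < d := Nat.pos_of_mul_pos_right hq
    have hm0 : 0 < m := Nat.pos_of_mul_pos_left hq
    rw [Nat.mul_div_cancel_left _ hd0]
    congr 2
    push_cast
    field_simp
  rw [hmoeb]
  refine (norm_sum_le _ _).trans ?_
  rw [← Nat.sum_div_divisors q (fun m => if (m : ℤ) ∣ n then (m : ℝ) else 0)]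
  refine Finset.sum_le_sum fun d hd => ?_
  rw [norm_mul]
  have h1 : ‖((ArithmeticFunction.moebius d : ℤ) : ℂ)‖ ≤ 1 := by
    rw [Complex.norm_intCast]
    exact_mod_cast ArithmeticFunction.abs_moebius_le_one
  have hpos : 0 < q / d := Nat.div_pos (Nat.divisor_le hd) (Nat.pos_of_mem_divisors hd)
  exact (mul_le_of_le_one_left (norm_nonneg _) h1).trans (norm_sum_expCirc_le hpos n)

/-- Multiples of `m` in `[1, N]`, each weighted by `m`, have total weight at most `N`. -/
theorem sum_Icc_ite_dvd_le (m N : ℕ) :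
    ∑ n ∈ Finset.Icc (1 : ℤ) (N : ℤ), (if (m : ℤ) ∣ n then (m : ℝ) else 0) ≤ N := by
  have hcard : ((Finset.Icc (1 : ℤ) (N : ℤ)).filter ((m : ℤ) ∣ ·)).card ≤ N / m := by
    rw [← Nat.Ioc_filter_dvd_card_eq_div N m]
    refine Finset.card_le_card_of_injOn Int.toNat ?_ ?_
    · intro n hn
      simp only [Finset.coe_filter, Finset.mem_Icc, Set.mem_ofPred_eq, Finset.mem_Ioc] at hn ⊢
      refine ⟨by omega, ?_⟩
      rw [← Int.natCast_dvd_natCast, Int.toNat_of_nonneg (by omega)]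
      exact hn.2
    · intro n hn n' hn' h
      simp only [Finset.coe_filter, Finset.mem_Icc, Set.mem_ofPred_eq] at hn hn'
      omega
  rw [← Finset.sum_filter, Finset.sum_const, nsmul_eq_mul]
  have h : ((Finset.Icc (1 : ℤ) (N : ℤ)).filter ((m : ℤ) ∣ ·)).card * m ≤ N :=
    (Nat.mul_le_mul_right m hcard).trans (Nat.div_mul_le_self N m)
  exact_mod_cast h

/-- The mean value over `n` of the Ramanujan sum `c_q(n)` is at most the number of divisors
of `q`. -/
theorem sum_norm_ramanujan_sum_le {q : ℕ} (hq : 0 < q) (N : ℕ) :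
    ∑ n ∈ Finset.Icc (1 : ℤ) (N : ℤ),
      ‖∑ a ∈ (Finset.Icc 1 q).filter (fun a => Nat.Coprime a q), expCirc ((n : ℝ) * a / q)‖ ≤
      N * q.divisors.card := by
  calc _ ≤ ∑ n ∈ Finset.Icc (1 : ℤ) (N : ℤ), ∑ m ∈ q.divisors,
        (if (m : ℤ) ∣ n then (m : ℝ) else 0) :=
        Finset.sum_le_sum fun n _ => norm_ramanujan_sum_le hq n
    _ = ∑ m ∈ q.divisors, ∑ n ∈ Finset.Icc (1 : ℤ) (N : ℤ),
        (if (m : ℤ) ∣ n then (m : ℝ) else 0) := Finset.sum_comm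
    _ ≤ ∑ m ∈ q.divisors, (N : ℝ) :=
        Finset.sum_le_sum fun m _ => sum_Icc_ite_dvd_le m N
    _ = N * q.divisors.card := by rw [Finset.sum_const, nsmul_eq_mul, mul_comm]

theorem sum_card_divisors_div_le {Q : ℝ} (hQ : 1 ≤ Q) :
    ∑ q ∈ Finset.Icc 1 ⌊Q⌋₊, (q.divisors.card : ℝ) / q ≤ (1 + Real.log Q) ^ 2 := by
  set M := ⌊Q⌋₊
  have hH : ∑ q ∈ Finset.Icc 1 M, ((q : ℝ))⁻¹ ≤ 1 + Real.log Q := by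
    have h := harmonic_floor_le_one_add_log Q hQ
    rw [harmonic_eq_sum_Icc] at h
    push_cast at h
    exact h
  have hH0 : 0 ≤ ∑ q ∈ Finset.Icc 1 M, ((q : ℝ))⁻¹ :=
    Finset.sum_nonneg fun q _ => by positivity
  refine le_trans ?_ (pow_le_pow_left₀ hH0 hH 2)
  have hfib (q : ℕ) (hq : q ∈ Finset.Icc 1 M) : (q.divisors.card : ℝ) / q =
      ∑ x ∈ (Finset.Icc 1 M ×ˢ Finset.Icc 1 M).filter (fun x => x.1 * x.2 = q),
        ((x.1 : ℝ))⁻¹ * ((x.2 : ℝ))⁻¹ := by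
    rw [Finset.mem_Icc] at hq
    have hanti : (Finset.Icc 1 M ×ˢ Finset.Icc 1 M).filter (fun x => x.1 * x.2 = q) =
        q.divisorsAntidiagonal :=
      (Nat.divisorsAntidiagonal_eq_prod_filter_of_le (by omega) hq.2).symm
    rw [hanti, Finset.sum_congr rfl (g := fun _ => (q : ℝ)⁻¹), Finset.sum_const, nsmul_eq_mul,
      ← Nat.map_div_right_divisors, Finset.card_map, div_eq_mul_inv]
    intro x hx
    rw [← (Nat.mem_divisorsAntidiagonal.1 hx).1]
    push_cast
    rw [mul_inv]
  rw [Finset.sum_congr rfl hfib, sq, Finset.sum_mul_sum, ← Finset.sum_product']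
  refine Finset.sum_fiberwise_le_sum_of_sum_fiber_nonneg fun q _ => ?_
  exact Finset.sum_nonneg fun x _ => by positivity

theorem tauApproxN_sub_eq (Q : ℝ) (N : ℕ) (n : ℤ) :
    tauApproxN Q N n - ((Real.log N : ℝ) : ℂ) * tauApprox Q n =
      ∑ q ∈ Finset.Icc 1 ⌊Q⌋₊, (((q : ℝ)⁻¹ *
        (2 * Real.eulerMascheroniConstant - 1 - 2 * Real.log q) : ℝ) : ℂ) *
        ∑ a ∈ (Finset.Icc 1 q).filter (fun a => Nat.Coprime a q),
          expCirc ((n : ℝ) * a / q) := by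
  rw [tauApproxN, tauApprox, Finset.mul_sum, ← Finset.sum_sub_distrib]
  refine Finset.sum_congr rfl fun q _ => ?_
  rw [Finset.mul_sum, Finset.mul_sum, ← Finset.sum_sub_distrib]
  refine Finset.sum_congr rfl fun a _ => ?_
  push_cast
  ring

/-- The `ℓ¹` distance of the two models is `O(N (log Q)^3)`, uniformly in `Q`. -/
theorem sum_norm_tauApproxN_sub_le {Q : ℝ} (hQ : 1 ≤ Q) (N : ℕ) :
    ∑ n ∈ Finset.Icc (1 : ℤ) (N : ℤ),
        ‖tauApproxN Q N n - ((Real.log N : ℝ) : ℂ) * tauApprox Q n‖ ≤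
      N * ((1 + 2 * Real.log Q) * (1 + Real.log Q) ^ 2) := by
  have hlogQ : 0 ≤ Real.log Q := Real.log_nonneg hQ
  have hcoef (q : ℕ) (hq : q ∈ Finset.Icc 1 ⌊Q⌋₊) :
      ‖(((q : ℝ)⁻¹ * (2 * Real.eulerMascheroniConstant - 1 - 2 * Real.log q) : ℝ) : ℂ)‖ ≤
        (q : ℝ)⁻¹ * (1 + 2 * Real.log Q) := by
    rw [Finset.mem_Icc] at hq
    have hq1 : (1 : ℝ) ≤ q := by exact_mod_cast hq.1
    have hqQ : (q : ℝ) ≤ Q := (Nat.le_floor_iff (by linarith)).1 hq.2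
    have h0 : 0 ≤ Real.log q := Real.log_nonneg hq1
    have h1 : Real.log q ≤ Real.log Q := Real.log_le_log (by linarith) hqQ
    rw [Complex.norm_real, Real.norm_eq_abs, abs_mul,
      abs_of_nonneg (by positivity : (0 : ℝ) ≤ (q : ℝ)⁻¹)]
    refine mul_le_mul_of_nonneg_left ?_ (by positivity)
    rw [abs_le]
    constructor <;>
      linarith [Real.one_half_lt_eulerMascheroniConstant,
        Real.eulerMascheroniConstant_lt_two_thirds]
  calc _ ≤ ∑ n ∈ Finset.Icc (1 : ℤ) (N : ℤ), ∑ q ∈ Finset.Icc 1 ⌊Q⌋₊,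
        (q : ℝ)⁻¹ * (1 + 2 * Real.log Q) *
          ‖∑ a ∈ (Finset.Icc 1 q).filter (fun a => Nat.Coprime a q),
            expCirc ((n : ℝ) * a / q)‖ := by
        refine Finset.sum_le_sum fun n _ => ?_
        rw [tauApproxN_sub_eq]
        refine (norm_sum_le _ _).trans (Finset.sum_le_sum fun q hq => ?_)
        rw [norm_mul]
        exact mul_le_mul_of_nonneg_right (hcoef q hq) (norm_nonneg _)
    _ = ∑ q ∈ Finset.Icc 1 ⌊Q⌋₊, (q : ℝ)⁻¹ * (1 + 2 * Real.log Q) *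
          ∑ n ∈ Finset.Icc (1 : ℤ) (N : ℤ),
          ‖∑ a ∈ (Finset.Icc 1 q).filter (fun a => Nat.Coprime a q),
            expCirc ((n : ℝ) * a / q)‖ := by
        rw [Finset.sum_comm]
        simp_rw [Finset.mul_sum]
    _ ≤ ∑ q ∈ Finset.Icc 1 ⌊Q⌋₊, (q : ℝ)⁻¹ * (1 + 2 * Real.log Q) *
          (N * q.divisors.card) := by
        refine Finset.sum_le_sum fun q hq => mul_le_mul_of_nonneg_left ?_ (by positivity)
        exact sum_norm_ramanujan_sum_le (Finset.mem_Icc.1 hq).1 N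
    _ = N * ((1 + 2 * Real.log Q) *
          ∑ q ∈ Finset.Icc 1 ⌊Q⌋₊, (q.divisors.card : ℝ) / q) := by
        rw [Finset.mul_sum, Finset.mul_sum]
        exact Finset.sum_congr rfl fun q _ => by ring
    _ ≤ _ := by
        have := sum_card_divisors_div_le hQ
        gcongr

/-- **Comparison of the two major-arc models for the divisor function.** For every
`0 < c ≤ 2^{-100}` there is a constant `C` such that, for all sufficiently large `N`,
with `Q = exp((log N)^c)`:
`(1/(N log N)) ∑_{n=1}^N |τ_{≤Q;N}(n) − (log N)·τ_{≤Q}(n)| ≤ C (log N)^{-1/10}`. -/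
theorem tauApprox_comparison (c : ℝ) (hc0 : 0 < c) (hc1 : c ≤ 2 ^ (-(100 : ℝ))) :
    ∃ C : ℝ, ∃ N₀ : ℕ, ∀ N : ℕ, N₀ ≤ N →
    ((N : ℝ) * Real.log N)⁻¹ *
        ∑ n ∈ Finset.Icc (1 : ℤ) (N : ℤ),
          ‖tauApproxN (Real.exp (Real.log N ^ c)) N n -
            ((Real.log N : ℝ) : ℂ) * tauApprox (Real.exp (Real.log N ^ c)) n‖ ≤
      C * Real.log N ^ (-(1 : ℝ) / 10) := by
  refine ⟨12, 3, fun N hN => ?_⟩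
  have hN3 : (3 : ℝ) ≤ N := by exact_mod_cast hN
  have hlog : 1 ≤ Real.log N := by
    rw [Real.le_log_iff_exp_le (by linarith)]
    linarith [Real.exp_one_lt_d9]
  have hL : 1 ≤ Real.log N ^ c := Real.one_le_rpow hlog hc0.le
  have hmain := sum_norm_tauApproxN_sub_le (Real.one_le_exp (zero_le_one.trans hL)) N
  rw [Real.log_exp] at hmain
  have hc : c ≤ 1 / 4 := by
    refine hc1.trans ?_
    rw [Real.rpow_neg (by norm_num)]
    norm_num
  have hcube : (1 + 2 * Real.log N ^ c) * (1 + Real.log N ^ c) ^ 2 ≤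
      12 * (Real.log N ^ c) ^ 3 := by
    set L := Real.log N ^ c
    calc (1 + 2 * L) * (1 + L) ^ 2 ≤ (3 * L) * (2 * L) ^ 2 := by gcongr <;> linarith
      _ = 12 * L ^ 3 := by ring
  have hpow : (Real.log N)⁻¹ * (Real.log N ^ c) ^ 3 ≤ Real.log N ^ (-(1 : ℝ) / 10) := by
    rw [← Real.rpow_neg_one, ← Real.rpow_natCast, ← Real.rpow_mul (by linarith),
      ← Real.rpow_add (by linarith)]
    exact Real.rpow_le_rpow_of_exponent_le hlog (by push_cast; linarith)
  calc _ ≤ ((N : ℝ) * Real.log N)⁻¹ * (N * (12 * (Real.log N ^ c) ^ 3)) := by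
        refine mul_le_mul_of_nonneg_left (hmain.trans ?_) (by positivity)
        gcongr
    _ = 12 * ((Real.log N)⁻¹ * (Real.log N ^ c) ^ 3) := by
        field_simp
    _ ≤ _ := by gcongr
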